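/- Let G be a finite undirected connected simple graph on N ≥ 2 vertices with combinatorial Laplacian L = D − A and largest Laplacian eigenvalue λ_N. Let κ > 0 and let x ∈ ℝ^N with x_i > 0 for all i and 1ᵀx = 1. Consider the symmetric 2N × 2N matrix J = [[−L + κ(xxᵀ + diag(x)² − diag(x)), κ(xxᵀ − diag(x))], [κ(xxᵀ − diag(x)), −L + κ(xxᵀ + diag(x)² − diag(x))]] (the Jacobian of the interaction vector field at a point with x = y), and list its eigenvalues in increasing order μ₁ ≤ μ₂ ≤ ⋯ ≤ μ_{2N}. Then μ_N ≥ −λ_N + κ·min_i x_i². In particular, if κ·min_i x_i² > λ_N, then J has at least N + 1 strictly positive eigenvalues. -/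

import Mathlib

open Matrix Finset SimpleGraph


lemma orth_dot {ι : Type*} [Fintype ι] {n : ℕ} (w : Fin n → ι → ℝ)
    (h : ∀ j k, w j ⬝ᵥ w k = if j = k then 1 else 0) (a b : Fin n → ℝ) :
    (∑ k, a k • w k) ⬝ᵥ (∑ k, b k • w k) = ∑ k, a k * b k := by
  simp only [sum_dotProduct, dotProduct_sum, smul_dotProduct, dotProduct_smul, h, smul_eq_mul]
  simp [mul_comm]

lemma eig_sum {ι : Type*} [Fintype ι] {n : ℕ} (w : Fin n → ι → ℝ) (M : Matrix ι ι ℝ)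
    (μ : Fin n → ℝ) (h : ∀ k, M.mulVec (w k) = μ k • w k) (a : Fin n → ℝ) :
    M.mulVec (∑ k, a k • w k) = ∑ k, (a k * μ k) • w k := by
  rw [Matrix.mulVec_sum]
  refine Finset.sum_congr rfl fun k _ => ?_
  rw [Matrix.mulVec_smul, h, smul_smul]

lemma quad_le {ι : Type*} [Fintype ι] {n : ℕ} (w : Fin n → ι → ℝ) (M : Matrix ι ι ℝ)
    (μ : Fin n → ℝ) (ho : ∀ j k, w j ⬝ᵥ w k = if j = k then 1 else 0)
    (h : ∀ k, M.mulVec (w k) = μ k • w k) (a : Fin n → ℝ) (c : ℝ) (hc : ∀ k, μ k ≤ c)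
    (z : ι → ℝ) (hz : z = ∑ k, a k • w k) :
    z ⬝ᵥ M.mulVec z ≤ c * (z ⬝ᵥ z) := by
  subst hz
  rw [eig_sum w M μ h, orth_dot w ho, orth_dot w ho, Finset.mul_sum]
  refine Finset.sum_le_sum fun k _ => ?_
  nlinarith [mul_le_mul_of_nonneg_right (hc k) (mul_self_nonneg (a k))]

lemma orth_repr {N : ℕ} (v : Fin N → Fin N → ℝ)
    (h : ∀ j k, v j ⬝ᵥ v k = if j = k then 1 else 0) (u : Fin N → ℝ) :
    u = ∑ k, (v k ⬝ᵥ u) • v k := by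
  let V : Matrix (Fin N) (Fin N) ℝ := Matrix.of v
  have h1 : V * Vᵀ = 1 := by
    ext i j
    rw [Matrix.one_apply, ← h i j]
    rfl
  have h2 : Vᵀ * V = 1 := mul_eq_one_comm.mp h1
  have h3 : Vᵀ *ᵥ (V *ᵥ u) = u := by rw [Matrix.mulVec_mulVec, h2, Matrix.one_mulVec]
  conv_lhs => rw [← h3]
  ext i
  simp only [Matrix.mulVec, Finset.sum_apply, Pi.smul_apply, smul_eq_mul]
  refine Finset.sum_congr rfl fun k _ => ?_
  rw [mul_comm]
  rfl

lemma exists_vec {N : ℕ} (w : Fin N → (Fin N ⊕ Fin N → ℝ))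
    (ho : ∀ j k, w j ⬝ᵥ w k = if j = k then 1 else 0) (hN : 0 < N) :
    ∃ (a u : Fin N → ℝ) (t : ℝ), 0 < ∑ k, a k * a k ∧
      (∑ k, a k • w k) = Sum.elim u (fun i => t - u i) := by
  let f : ((Fin N → ℝ) × (Fin N → ℝ) × ℝ) →ₗ[ℝ] (Fin N ⊕ Fin N → ℝ) :=
    { toFun := fun p => (∑ k, p.1 k • w k) - Sum.elim p.2.1 (fun i => p.2.2 - p.2.1 i)
      map_add' := by
        intro p q
        ext i
        rcases i with i | i <;> simp [add_mul, Finset.sum_add_distrib] <;> ring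
      map_smul' := by
        intro c p
        ext i
        rcases i with i | i <;> simp [mul_assoc, ← Finset.mul_sum] <;> ring }
  have hker : LinearMap.ker f ≠ ⊥ := by
    apply LinearMap.ker_ne_bot_of_finrank_lt
    simp
  obtain ⟨p, hp, hp0⟩ := Submodule.exists_mem_ne_zero_of_ne_bot hker
  obtain ⟨a, u, t⟩ := p
  have he : (∑ k, a k • w k) = Sum.elim u (fun i => t - u i) := sub_eq_zero.mp hp
  refine ⟨a, u, t, ?_, he⟩
  refine lt_of_le_of_ne (Finset.sum_nonneg fun k _ => mul_self_nonneg _) fun h0 => hp0 ?_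
  have ha : a = 0 := by
    ext k
    have := (Finset.sum_eq_zero_iff_of_nonneg (fun k _ => mul_self_nonneg (a k))).mp h0.symm k
      (Finset.mem_univ k)
    simpa using this
  subst ha
  have hu : u = 0 := by
    ext i
    have := congrFun he (Sum.inl i)
    simpa using this.symm
  subst hu
  have ht : t = 0 := by
    have := congrFun he (Sum.inr ⟨0, hN⟩)
    simpa using this.symm
  subst ht
  rfl

lemma J_top {N : ℕ} (L : Matrix (Fin N) (Fin N) ℝ) (κ : ℝ) (x : Fin N → ℝ)
    (hsum : ∑ i, x i = 1) (u v : Fin N → ℝ) (t : ℝ) (huv : ∀ i, u i + v i = t) :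
    (-L + κ • (Matrix.vecMulVec x x
        + Matrix.diagonal x * Matrix.diagonal x - Matrix.diagonal x)) *ᵥ u +
      (κ • (Matrix.vecMulVec x x - Matrix.diagonal x)) *ᵥ v =
    fun i => -(L *ᵥ u) i + κ * (x i ^ 2 * u i) := by
  have hxs : x ⬝ᵥ u + x ⬝ᵥ v = t := by
    rw [← dotProduct_add]
    have : u + v = fun _ => t := funext huv
    rw [this]
    simp [dotProduct, ← Finset.sum_mul, hsum]
  ext i
  simp only [Matrix.add_mulVec, Matrix.sub_mulVec, Matrix.smul_mulVec, Matrix.neg_mulVec,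
    Matrix.vecMulVec_mulVec, Matrix.diagonal_mul_diagonal, Matrix.mulVec_diagonal, Pi.add_apply,
    Pi.sub_apply, Pi.neg_apply, Pi.smul_apply, smul_eq_mul, MulOpposite.smul_eq_mul_unop,
    MulOpposite.unop_op]
  have e1 := huv i
  linear_combination κ * x i * hxs - κ * x i * e1

/-- Weyl-inequality lower bound for the `N`-th smallest eigenvalue of the
Jacobian of the interaction vector field at a point with `x = y`; in particular if
`κ · minᵢ xᵢ² > λ_N` then the Jacobian has at least `N + 1` strictly positive
eigenvalues. -/
theorem jacobian_eigenvalue_bound (N : ℕ) (hN : 2 ≤ N)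
    (G : SimpleGraph (Fin N)) [DecidableRel G.Adj] (hconn : G.Connected)
    (L : Matrix (Fin N) (Fin N) ℝ)
    (hL : L = Matrix.diagonal (fun i => (G.degree i : ℝ)) - G.adjMatrix ℝ)
    (lam : Fin N → ℝ) (vL : Fin N → (Fin N → ℝ))
    (hmono : Monotone lam)
    (horthL : ∀ j k, vL j ⬝ᵥ vL k = if j = k then 1 else 0)
    (heigL : ∀ k, L.mulVec (vL k) = lam k • vL k)
    (κ : ℝ) (hκ : 0 < κ)
    (x : Fin N → ℝ) (hx : ∀ i, 0 < x i) (hsum : ∑ i, x i = 1)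
    (J : Matrix (Fin N ⊕ Fin N) (Fin N ⊕ Fin N) ℝ)
    (hJ : J = Matrix.fromBlocks
      (-L + κ • (Matrix.vecMulVec x x
        + Matrix.diagonal x * Matrix.diagonal x - Matrix.diagonal x))
      (κ • (Matrix.vecMulVec x x - Matrix.diagonal x))
      (κ • (Matrix.vecMulVec x x - Matrix.diagonal x))
      (-L + κ • (Matrix.vecMulVec x x
        + Matrix.diagonal x * Matrix.diagonal x - Matrix.diagonal x)))
    (μ : Fin (2 * N) → ℝ) (w : Fin (2 * N) → (Fin N ⊕ Fin N → ℝ))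
    (hμmono : Monotone μ)
    (horthJ : ∀ j k, w j ⬝ᵥ w k = if j = k then 1 else 0)
    (heigJ : ∀ k, J.mulVec (w k) = μ k • w k) :
    -lam ⟨N - 1, by omega⟩
        + κ * Finset.univ.inf' (Finset.univ_nonempty_iff.mpr ⟨⟨0, by omega⟩⟩)
            (fun i => x i ^ 2)
      ≤ μ ⟨N - 1, by omega⟩ ∧
    (lam ⟨N - 1, by omega⟩
        < κ * Finset.univ.inf' (Finset.univ_nonempty_iff.mpr ⟨⟨0, by omega⟩⟩)
            (fun i => x i ^ 2) →
      N + 1 ≤ (Finset.univ.filter (fun k => 0 < μ k)).card) := by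
  set m := Finset.univ.inf' (Finset.univ_nonempty_iff.mpr ⟨⟨0, by omega⟩⟩)
            (fun i => x i ^ 2) with hm
  have hmle : ∀ i, m ≤ x i ^ 2 := fun i => Finset.inf'_le _ (Finset.mem_univ i)
  have hLb : ∀ u : Fin N → ℝ, u ⬝ᵥ L *ᵥ u ≤ lam ⟨N - 1, by omega⟩ * (u ⬝ᵥ u) := fun u =>
    quad_le vL L lam horthL heigL _ _
      (fun k => hmono (Fin.mk_le_mk.mpr (by have := k.2; omega))) u (orth_repr vL horthL u)
  have hhalf : ∀ u : Fin N → ℝ,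
      (-lam ⟨N - 1, by omega⟩ + κ * m) * (u ⬝ᵥ u) ≤
        u ⬝ᵥ (fun i => -(L *ᵥ u) i + κ * (x i ^ 2 * u i)) := by
    intro u
    have h1 : u ⬝ᵥ (fun i => -(L *ᵥ u) i + κ * (x i ^ 2 * u i)) =
        -(u ⬝ᵥ L *ᵥ u) + κ * ∑ i, x i ^ 2 * (u i * u i) := by
      simp only [dotProduct, mul_add, Finset.sum_add_distrib, Finset.mul_sum, mul_neg,
        Finset.sum_neg_distrib]
      congr 1
      refine Finset.sum_congr rfl fun i _ => ?_
      ring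
    have h2 : m * (u ⬝ᵥ u) ≤ ∑ i, x i ^ 2 * (u i * u i) := by
      simp only [dotProduct, Finset.mul_sum]
      exact Finset.sum_le_sum fun i _ =>
        mul_le_mul_of_nonneg_right (hmle i) (mul_self_nonneg _)
    rw [h1]
    nlinarith [hLb u, mul_le_mul_of_nonneg_left h2 hκ.le]
  have key : -lam ⟨N - 1, by omega⟩ + κ * m ≤ μ ⟨N - 1, by omega⟩ := by
    let e : Fin N → Fin (2 * N) := fun k => ⟨k.1, by have := k.2; omega⟩
    have ho : ∀ j k, w (e j) ⬝ᵥ w (e k) = if j = k then 1 else 0 := by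
      intro j k
      rw [horthJ]
      simp [e, Fin.ext_iff]
    obtain ⟨a, u, t, hpos, hz⟩ := exists_vec (fun k => w (e k)) ho (by omega)
    have hup := quad_le (fun k => w (e k)) J (fun k => μ (e k)) ho (fun k => heigJ (e k)) a
      (μ ⟨N - 1, by omega⟩)
      (fun k => hμmono (Fin.mk_le_mk.mpr (by have := k.2; omega))) _ hz.symm
    have hzz := orth_dot (fun k => w (e k)) ho a a
    rw [hz] at hzz
    set v : Fin N → ℝ := fun i => t - u i with hv
    have hJz : J *ᵥ (Sum.elim u v) = Sum.elim (fun i => -(L *ᵥ u) i + κ * (x i ^ 2 * u i))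
        (fun i => -(L *ᵥ v) i + κ * (x i ^ 2 * v i)) := by
      rw [hJ, Matrix.fromBlocks_mulVec]
      simp only [Sum.elim_comp_inl, Sum.elim_comp_inr]
      rw [J_top L κ x hsum u v t (fun i => by simp [hv]), add_comm,
        J_top L κ x hsum v u t (fun i => by simp [hv])]
    rw [hJz, sumElim_dotProduct_sumElim] at hup
    have h1 := hhalf u
    have h2 := hhalf v
    rw [← hzz] at hpos
    have hs : Sum.elim u v ⬝ᵥ Sum.elim u v = u ⬝ᵥ u + v ⬝ᵥ v := sumElim_dotProduct_sumElim ..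
    rw [hs] at hpos hup
    refine le_of_mul_le_mul_right ?_ hpos
    linarith
  refine ⟨key, fun hlt => ?_⟩
  have hsub : Finset.Ici (⟨N - 1, by omega⟩ : Fin (2 * N)) ⊆
      Finset.univ.filter (fun k => 0 < μ k) := by
    intro k hk
    simp only [Finset.mem_filter, Finset.mem_univ, true_and]
    have := hμmono (Finset.mem_Ici.mp hk)
    linarith
  have hc := Finset.card_le_card hsub
  rw [Fin.card_Ici] at hc
  simp only at hc
  omega
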